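/- arXiv:math/9811035 — 2 statements merged into one kernel-verified Lean document; each statement's English description precedes it below -/
import Mathlib

section
/- Let J be a reduced Albert algebra over a field F of characteristic not 2 or 3. Then for every ζ ∈ F^×, the algebra with involution B(J,F×F,ζ) is isomorphic to B(J,F×F) (an isomorphism being a bijective F-linear map preserving products and commuting with the involutions). -/
set_option synthInstance.maxHeartbeats 1000000
set_option maxHeartbeats 1000000

noncomputable section

open scoped TensorProduct

universe u v

structure OctonionAlgebra (F : Type u) [Field F] : Type (max u (v + 1)) where
  C : Type v
  [ringC : NonAssocRing C]
  [modC : Module F C]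
  [sccC : SMulCommClass F C C]
  [istC : IsScalarTower F C C]
  n : QuadraticForm F C
  finrank_eq : Module.finrank F C = 8
  nondeg : ∀ x : C, (∀ y : C, QuadraticMap.polar (⇑n) x y = 0) → x = 0
  n_one : n 1 = 1
  n_mul : ∀ x y : C, n (x * y) = n x * n y

attribute [instance] OctonionAlgebra.ringC OctonionAlgebra.modC OctonionAlgebra.sccC
  OctonionAlgebra.istC

namespace OctonionAlgebra

variable {F : Type u} [Field F] (O : OctonionAlgebra.{u, v} F)

/-- Conjugation `x̄ := n(x,1)•1 - x` (bundled as a linear map; `polarBilin n x 1 = n(x,1)`). -/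
def conj : O.C →ₗ[F] O.C :=
  (LinearMap.toSpanSingleton F O.C (1 : O.C)).comp ((QuadraticMap.polarBilin O.n).flip 1)
    - LinearMap.id

lemma conj_apply (x : O.C) :
    O.conj x = QuadraticMap.polar (⇑O.n) x 1 • (1 : O.C) - x := rfl

/-- A split octonion algebra: the norm form is isotropic. -/
def IsSplit : Prop := ∃ x : O.C, x ≠ 0 ∧ O.n x = 0

end OctonionAlgebra

/-- A reduced Albert algebra `H₃(C,γ)`. -/
structure ReducedAlbert (F : Type u) [Field F] : Type (max u (v + 1)) where
  O : OctonionAlgebra.{u, v} F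
  γ : Fin 3 → Fˣ

namespace ReducedAlbert

variable {F : Type u} [Field F] (A : ReducedAlbert.{u, v} F)

/-- The ambient space of 3×3 matrices over the octonion algebra. -/
abbrev M : Type v := Matrix (Fin 3) (Fin 3) A.O.C

/-- The 27-dimensional space `H₃(C,γ)` of `γ`-hermitian matrices:
`x = γ⁻¹ ⬝ (x̄)ᵀ ⬝ γ`, i.e. entrywise `x i j = γᵢ⁻¹ γⱼ • conj (x j i)`. -/
def J : Submodule F A.M where
  carrier := {x | ∀ i j, x i j = ((A.γ i : F)⁻¹ * (A.γ j : F)) • A.O.conj (x j i)}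
  add_mem' := by
    intro a b ha hb i j
    show a i j + b i j = ((A.γ i : F)⁻¹ * (A.γ j : F)) • A.O.conj (a j i + b j i)
    rw [map_add, smul_add, ← ha i j, ← hb i j]
  zero_mem' := by
    intro i j
    show (0 : A.O.C) = ((A.γ i : F)⁻¹ * (A.γ j : F)) • A.O.conj (0 : A.O.C)
    rw [map_zero, smul_zero]
  smul_mem' := by
    intro c a ha i j
    show c • a i j = ((A.γ i : F)⁻¹ * (A.γ j : F)) • A.O.conj (c • a j i)
    rw [map_smul, smul_comm, ← ha i j]

/-- The Jordan product `x·y := (xy + yx)/2`. -/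
def jmul (x y : A.M) : A.M := (2 : F)⁻¹ • (x * y + y * x)

/-- The trace `T(x)`: the sum of the diagonal entries, which for hermitian matrices are
scalars `ε•1`; the scalar `ε` is recovered as `n(ε•1, 1)/2`. -/
def trace (x : A.M) : F := (2 : F)⁻¹ * ∑ i, QuadraticMap.polar (⇑A.O.n) (x i i) 1

/-- The trace bilinear form `T(x,y) := T(x·y)`. -/
def tb (x y : A.M) : F := A.trace (A.jmul x y)

/-- The adjoint `x ^ # = x·x − T(x)·x + ½(T(x)² − T(x,x))·1`, the unique quadratic map such
that `T(x^#, y)` is the coefficient of `s` in `N(x + s y)`. -/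
def sharp (x : A.M) : A.M :=
  A.jmul x x - A.trace x • x + ((2 : F)⁻¹ * (A.trace x ^ 2 - A.tb x x)) • (1 : A.M)

/-- The Freudenthal cross product `x × y := (x+y)^# − x^# − y^#`. -/
def cross (x y : A.M) : A.M := A.sharp (x + y) - A.sharp x - A.sharp y

/-- The cubic norm `N`, defined pointwise on `J` by
`N(x)·1 = x·(x·x) − T(x)·(x·x) + ½(T(x)² − T(x,x))·x`; the scalar is recovered by
applying the trace (which takes value `3` on `1`). -/
def norm (x : A.M) : F :=
  (3 : F)⁻¹ * A.trace (A.jmul x (A.jmul x x) - A.trace x • A.jmul x x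
    + ((2 : F)⁻¹ * (A.trace x ^ 2 - A.tb x x)) • x)

/-- The operator `⟨x,y⟩(j) := ½ (y × (x × j) − T(j,y)·x − ⅓·T(x,y)·j)`. -/
def brok (x y j : A.M) : A.M :=
  (2 : F)⁻¹ • (A.cross y (A.cross x j) - A.tb j y • x - ((3 : F)⁻¹ * A.tb x y) • j)

/-- `A` is the split Albert algebra `H₃(Cᵈ, 1)`. -/
def IsSplitAlbert : Prop := A.O.IsSplit ∧ ∀ i, A.γ i = 1

/-- A point of `H₃(C,γ)` with coordinates `(ε₀,ε₁,ε₂; a,b,c)`. -/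
def elt (ε : Fin 3 → F) (a b c : A.O.C) : A.M :=
  Matrix.of
    ![![ε 0 • (1 : A.O.C), c, ((A.γ 0 : F)⁻¹ * (A.γ 2 : F)) • A.O.conj b],
      ![((A.γ 1 : F)⁻¹ * (A.γ 0 : F)) • A.O.conj c, ε 1 • (1 : A.O.C), a],
      ![b, ((A.γ 2 : F)⁻¹ * (A.γ 1 : F)) • A.O.conj a, ε 2 • (1 : A.O.C)]]

/-! ### The Brown algebra `B(J, F×F, ζ)` -/

/-- Ambient space of the Brown algebra `B(J, F×F, ζ)`: elements `(α, j; j', β)`. -/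
abbrev Bam : Type (max u v) := F × A.M × A.M × F

/-- The underlying 56-dimensional space of `B(J, F×F, ζ)`: both middle components lie in `J`. -/
def Bsub : Submodule F A.Bam where
  carrier := {p | p.2.1 ∈ A.J ∧ p.2.2.1 ∈ A.J}
  add_mem' := fun ha hb => ⟨A.J.add_mem ha.1 hb.1, A.J.add_mem ha.2 hb.2⟩
  zero_mem' := ⟨A.J.zero_mem, A.J.zero_mem⟩
  smul_mem' := fun c _ h => ⟨A.J.smul_mem c h.1, A.J.smul_mem c h.2⟩

/-- The product of `B(J, F×F, ζ)`. -/
def bmul (ζ : F) (x y : A.Bam) : A.Bam :=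
  (x.1 * y.1 + ζ * A.tb x.2.1 y.2.2.1,
   x.1 • y.2.1 + y.2.2.2 • x.2.1 + ζ • A.cross x.2.2.1 y.2.2.1,
   y.1 • x.2.2.1 + x.2.2.2 • y.2.2.1 + A.cross x.2.1 y.2.1,
   x.2.2.2 * y.2.2.2 + ζ * A.tb y.2.1 x.2.2.1)

/-- The involution `(α,j;j',β)‾ = (β,j;j',α)` of `B(J, F×F, ζ)`. -/
def binv (x : A.Bam) : A.Bam := (x.2.2.2, x.2.1, x.2.2.1, x.1)

/-- The skew-symmetric element `s₀ = (1,0;0,−1)`. -/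
def s0 : A.Bam := (1, 0, 0, -1)

/-- The triple product `{x,y,z} := (x·ȳ)·z + (z·ȳ)·x − (z·x̄)·y` in `B(J, F×F, ζ)`. -/
def brace (ζ : F) (x y z : A.Bam) : A.Bam :=
  A.bmul ζ (A.bmul ζ x (A.binv y)) z + A.bmul ζ (A.bmul ζ z (A.binv y)) x
    - A.bmul ζ (A.bmul ζ z (A.binv x)) y

/-- The bilinear form of the triple system associated to `B(J, F×F, ζ)` and a skew element
`s`: `b(x,y)` is the unique scalar with `b(x,y)•1 = (x·ȳ − y·x̄)·s`; since the unit of the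
algebra is `(1,0;0,1)`, it is the first component of the right-hand side. -/
def bformS (ζ : F) (s x y : A.Bam) : F :=
  (A.bmul ζ (A.bmul ζ x (A.binv y) - A.bmul ζ y (A.binv x)) s).1

/-- The trilinear product of the triple system associated to `B(J, F×F, ζ)` and `s`:
`t(y,z,w) := 2{y, s·z, w} − b(z,w)·y − b(z,y)·w − b(y,w)·z`. -/
def tformS (ζ : F) (s y z w : A.Bam) : A.Bam :=
  (2 : F) • A.brace ζ y (A.bmul ζ s z) w - A.bformS ζ s z w • y - A.bformS ζ s z y • w
    - A.bformS ζ s y w • z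

/-- The bilinear form of the triple system associated to `B(J, F×F, ζ)` and `s₀`. -/
def bform (ζ : F) (x y : A.Bam) : F := A.bformS ζ A.s0 x y

/-- The trilinear product of the triple system associated to `B(J, F×F, ζ)` and `s₀`. -/
def tform (ζ : F) (y z w : A.Bam) : A.Bam := A.tformS ζ A.s0 y z w

/-- `e` is a singular element of `B(J, F×F, ζ)`: `e ≠ 0` and `U_e(B) ⊆ F·e`
where `U_e(x) := {e,x,e}`. -/
def IsSingular (ζ : F) (e : A.Bam) : Prop :=
  e ≠ 0 ∧ ∀ x ∈ A.Bsub, ∃ c : F, A.brace ζ e x e = c • e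

/-- `I` is an inner ideal of `B(J, F×F, ζ)`: a subspace of `B` with `U_e(B) ⊆ I`
for all `e ∈ I`. -/
def IsInnerIdeal (ζ : F) (I : Submodule F A.Bam) : Prop :=
  I ≤ A.Bsub ∧ ∀ e ∈ I, ∀ x ∈ A.Bsub, A.brace ζ e x e ∈ I

end ReducedAlbert

lemma Fin.sum_univ_three_of_ne {M : Type*} [AddCommMonoid M] {i j k : Fin 3} (hij : i ≠ j)
    (hik : i ≠ k) (hjk : j ≠ k) (f : Fin 3 → M) : ∑ l, f l = f i + f j + f k := by
  rw [Fin.sum_univ_three]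
  fin_cases i <;> fin_cases j <;> fin_cases k <;> simp_all <;> abel

namespace OctonionAlgebra

variable {F : Type u} [Field F] (O : OctonionAlgebra.{u, v} F)

/-- Linearization of `n (x * y) = n x * n y` in the left factor. -/
lemma polar_mul_right (x y z : O.C) :
    QuadraticMap.polar O.n (x * y) (z * y) = QuadraticMap.polar O.n x z * O.n y := by
  simp only [QuadraticMap.polar, ← add_mul, O.n_mul]
  ring

/-- The adjoint of right multiplication by `y` is right multiplication by its conjugate. -/
lemma polar_mul_conj (x y z : O.C) :
    QuadraticMap.polar O.n (x * O.conj y) z = QuadraticMap.polar O.n x (z * y) := by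
  have h := O.polar_mul_right x (y + 1) z
  have hn : O.n (y + 1) = O.n y + 1 + QuadraticMap.polar O.n y 1 := by
    simp only [QuadraticMap.polar, O.n_one]
    ring
  simp only [mul_add, mul_one, QuadraticMap.polar_add_left, QuadraticMap.polar_add_right,
    O.polar_mul_right, hn] at h
  rw [O.conj_apply, mul_sub, mul_smul_comm, mul_one, QuadraticMap.polar_sub_left,
    QuadraticMap.polar_smul_left, smul_eq_mul]
  linear_combination -h

lemma mul_conj (x : O.C) : x * O.conj x = O.n x • (1 : O.C) := by
  rw [← sub_eq_zero]
  refine O.nondeg _ fun y => ?_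
  have h := O.polar_mul_right 1 x y
  rw [one_mul] at h
  rw [QuadraticMap.polar_sub_left, O.polar_mul_conj, h, QuadraticMap.polar_smul_left,
    smul_eq_mul]
  ring

lemma conj_mul (x : O.C) : O.conj x * x = O.n x • (1 : O.C) := by
  rw [← O.mul_conj, O.conj_apply, sub_mul, mul_sub, smul_mul_assoc, mul_smul_comm, one_mul,
    mul_one]

/-- Half of the trace of an octonion, which recovers `ε` from `ε • 1`. -/
def halfTrace : O.C →ₗ[F] F := (2 : F)⁻¹ • (QuadraticMap.polarBilin O.n).flip 1

lemma halfTrace_apply (x : O.C) :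
    O.halfTrace x = (2 : F)⁻¹ * QuadraticMap.polar O.n x 1 := rfl

lemma halfTrace_one (h2 : (2 : F) ≠ 0) : O.halfTrace 1 = 1 := by
  rw [O.halfTrace_apply, QuadraticMap.polar_self, O.n_one, nsmul_one, Nat.cast_ofNat,
    inv_mul_cancel₀ h2]

lemma eq_halfTrace_smul_one (h2 : (2 : F) ≠ 0) {x : O.C} (hx : x = O.conj x) :
    x = O.halfTrace x • (1 : O.C) := by
  have h : (2 : F) • x = QuadraticMap.polar O.n x 1 • (1 : O.C) := by
    rw [two_smul]
    nth_rewrite 1 [hx]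
    rw [O.conj_apply, sub_add_cancel]
  rw [O.halfTrace_apply, mul_smul, ← h, smul_smul, inv_mul_cancel₀ h2, one_smul]

end OctonionAlgebra

namespace ReducedAlbert

variable {F : Type u} [Field F] (A : ReducedAlbert.{u, v} F)

lemma trace_eq (x : A.M) : A.trace x = ∑ i, A.O.halfTrace (x i i) := by
  simp only [trace, Finset.mul_sum, A.O.halfTrace_apply]

lemma jmul_self (h2 : (2 : F) ≠ 0) (x : A.M) : A.jmul x x = x * x := by
  rw [jmul, ← two_smul F, smul_smul, inv_mul_cancel₀ h2, one_smul]

variable {A}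

lemma J_diag (h2 : (2 : F) ≠ 0) {x : A.M} (hx : x ∈ A.J) (i : Fin 3) :
    x i i = A.O.halfTrace (x i i) • (1 : A.O.C) := by
  refine A.O.eq_halfTrace_smul_one h2 ?_
  have h := hx i i
  rwa [inv_mul_cancel₀ (A.γ i).ne_zero, one_smul] at h

lemma J_mul_swap {x : A.M} (hx : x ∈ A.J) (i j : Fin 3) :
    ∃ c : F, x i j * x j i = c • (1 : A.O.C) ∧ x j i * x i j = c • (1 : A.O.C) := by
  refine ⟨((A.γ j : F)⁻¹ * (A.γ i : F)) * A.O.n (x i j), ?_, ?_⟩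
  · rw [hx j i, mul_smul_comm, A.O.mul_conj, smul_smul]
  · rw [hx j i, smul_mul_assoc, A.O.conj_mul, smul_smul]

/-- The entries of the adjoint of a hermitian matrix off the diagonal. -/
lemma sharp_apply_of_ne (h2 : (2 : F) ≠ 0) {x : A.M} (hx : x ∈ A.J) {i j k : Fin 3}
    (hij : i ≠ j) (hik : i ≠ k) (hjk : j ≠ k) :
    A.sharp x i j = x i k * x k j - A.O.halfTrace (x k k) • x i j := by
  simp only [sharp, A.jmul_self h2, Matrix.add_apply, Matrix.sub_apply, Matrix.smul_apply,
    Matrix.one_apply_ne hij, smul_zero, add_zero, Matrix.mul_apply, trace_eq,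
    Fin.sum_univ_three_of_ne hij hik hjk]
  nth_rewrite 1 [J_diag h2 hx i]
  nth_rewrite 1 [J_diag h2 hx j]
  rw [smul_mul_assoc, mul_smul_comm, one_mul, mul_one]
  module

/-- The diagonal entries of the adjoint of a hermitian matrix. -/
lemma sharp_apply_self (h2 : (2 : F) ≠ 0) {x : A.M} (hx : x ∈ A.J) {i j k : Fin 3}
    (hij : i ≠ j) (hik : i ≠ k) (hjk : j ≠ k) :
    A.sharp x i i =
      (A.O.halfTrace (x j j) * A.O.halfTrace (x k k)) • (1 : A.O.C) - x j k * x k j := by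
  obtain ⟨c, hc, hc'⟩ := J_mul_swap hx i j
  obtain ⟨d, hd, hd'⟩ := J_mul_swap hx i k
  obtain ⟨e, he, he'⟩ := J_mul_swap hx j k
  simp only [sharp, tb, A.jmul_self h2, Matrix.add_apply, Matrix.sub_apply, Matrix.smul_apply,
    Matrix.one_apply_eq, Matrix.mul_apply, trace_eq,
    Fin.sum_univ_three_of_ne hij hik hjk,
    hc, hc', hd, hd', he, he']
  obtain ⟨p, hp⟩ : ∃ p : F, x i i = p • (1 : A.O.C) := ⟨_, J_diag h2 hx i⟩
  obtain ⟨q, hq⟩ : ∃ q : F, x j j = q • (1 : A.O.C) := ⟨_, J_diag h2 hx j⟩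
  obtain ⟨r, hr⟩ : ∃ r : F, x k k = r • (1 : A.O.C) := ⟨_, J_diag h2 hx k⟩
  simp only [hp, hq, hr, smul_mul_assoc, one_mul, map_smul, A.O.halfTrace_one h2,
    smul_eq_mul, mul_one, smul_smul, ← add_smul, ← sub_smul]
  congr 1
  field_simp
  ring

variable (A)

/-- Multiplication of the entries of a matrix by the given scalars. -/
def scale (w : Fin 3 → Fin 3 → F) : A.M →ₗ[F] A.M where
  toFun x := Matrix.of fun i j => w i j • x i j
  map_add' x y := by
    ext i j
    exact smul_add _ _ _
  map_smul' c x := by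
    ext i j
    exact smul_comm _ _ _

lemma scale_apply (w : Fin 3 → Fin 3 → F) (x : A.M) (i j : Fin 3) :
    A.scale w x i j = w i j • x i j := rfl

variable {A}

lemma scale_mem_J {w : Fin 3 → Fin 3 → F} (hw : ∀ i j, w i j = w j i) {x : A.M}
    (hx : x ∈ A.J) : A.scale w x ∈ A.J := by
  intro i j
  rw [scale_apply, scale_apply, map_smul, smul_comm, ← hx i j, hw i j]

lemma scale_scale_eq_self {w w' : Fin 3 → Fin 3 → F} (h : ∀ i j, w i j * w' i j = 1)
    (x : A.M) : A.scale w (A.scale w' x) = x := by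
  ext i j
  rw [scale_apply, scale_apply, smul_smul, h, one_smul]

lemma sharp_scale (h2 : (2 : F) ≠ 0) {w q : Fin 3 → Fin 3 → F}
    (hsymm : ∀ i j, w i j = w j i) (hw : ∀ i j k, w i k * w k j = w k k * w i j)
    (hq : ∀ i j k, i ≠ j → i ≠ k → j ≠ k → q i j = w k k * w i j ∧ q i i = w j j * w k k)
    {x : A.M} (hx : x ∈ A.J) : A.sharp (A.scale w x) = A.scale q (A.sharp x) := by
  have hx' := scale_mem_J hsymm hx
  have key : ∀ i j k : Fin 3, i ≠ j → i ≠ k → j ≠ k →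
      A.sharp (A.scale w x) i j = A.scale q (A.sharp x) i j ∧
      A.sharp (A.scale w x) i i = A.scale q (A.sharp x) i i := by
    intro i j k hij hik hjk
    obtain ⟨h₁, h₂⟩ := hq i j k hij hik hjk
    have h₃ : w j k * w k j = w j j * w k k := by rw [hw j j k, mul_comm]
    constructor
    · rw [scale_apply, sharp_apply_of_ne h2 hx' hij hik hjk, sharp_apply_of_ne h2 hx hij hik hjk]
      simp only [scale_apply, smul_mul_assoc, mul_smul_comm, map_smul, smul_smul, smul_sub,
        smul_eq_mul]
      rw [mul_comm (w k j), hw, h₁]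
      module
    · rw [scale_apply, sharp_apply_self h2 hx' hij hik hjk, sharp_apply_self h2 hx hij hik hjk]
      simp only [scale_apply, smul_mul_assoc, mul_smul_comm, map_smul, smul_smul, smul_sub,
        smul_eq_mul]
      rw [mul_comm (w k j), h₃, h₂]
      module
  have hne : ∀ i j : Fin 3, ∃ k l : Fin 3, i ≠ k ∧ i ≠ l ∧ k ≠ l ∧ (i = j ∨ k = j) := by decide
  ext i j
  obtain ⟨k, l, hik, hil, hkl, rfl | rfl⟩ := hne i j
  · exact (key i k l hik hil hkl).2
  · exact (key i k l hik hil hkl).1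

lemma cross_scale (h2 : (2 : F) ≠ 0) {w q : Fin 3 → Fin 3 → F}
    (hsymm : ∀ i j, w i j = w j i) (hw : ∀ i j k, w i k * w k j = w k k * w i j)
    (hq : ∀ i j k, i ≠ j → i ≠ k → j ≠ k → q i j = w k k * w i j ∧ q i i = w j j * w k k)
    {x y : A.M} (hx : x ∈ A.J) (hy : y ∈ A.J) :
    A.cross (A.scale w x) (A.scale w y) = A.scale q (A.cross x y) := by
  rw [cross, cross, ← map_add, sharp_scale h2 hsymm hw hq (A.J.add_mem hx hy),
    sharp_scale h2 hsymm hw hq hx, sharp_scale h2 hsymm hw hq hy, map_sub, map_sub]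

lemma tb_scale {w w' : Fin 3 → Fin 3 → F} {c : F} (h : ∀ i j, w i j * w' j i = c)
    (x y : A.M) : A.tb (A.scale w x) (A.scale w' y) = c * A.tb x y := by
  simp only [tb, jmul, trace_eq, Matrix.smul_apply, Matrix.add_apply, Matrix.mul_apply,
    scale_apply, smul_mul_assoc, mul_smul_comm, smul_smul, mul_comm (w' _ _) (w _ _), h,
    ← Finset.smul_sum, ← smul_add, smul_comm _ c, map_smul,
    smul_eq_mul, ← Finset.mul_sum]
  ring

/-- Scalars of a norm similarity of `H₃(C,γ)` with multiplier `z`. They are the products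
`dᵢ * dⱼ` for `d = (√z, √z, 1/√z)`. -/
def similarityWeight (z : F) : Fin 3 → Fin 3 → F :=
  ![![z, z, 1], ![z, z, 1], ![1, 1, z⁻¹]]

/-- Scalars of the trace adjoint inverse of `similarityWeight z`, multiplied by `z`. -/
def similarityWeightDual (z : F) : Fin 3 → Fin 3 → F :=
  ![![1, 1, z], ![1, 1, z], ![z, z, z ^ 2]]

lemma similarityWeight_symm (z : F) (i j : Fin 3) :
    similarityWeight z i j = similarityWeight z j i := by
  fin_cases i <;> fin_cases j <;> rfl

lemma similarityWeightDual_symm (z : F) (i j : Fin 3) :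
    similarityWeightDual z i j = similarityWeightDual z j i := by
  fin_cases i <;> fin_cases j <;> rfl

lemma similarityWeight_mul_dual {z : F} (hz : z ≠ 0) (i j : Fin 3) :
    similarityWeight z i j * similarityWeightDual z i j = z := by
  fin_cases i <;> fin_cases j <;> simp [similarityWeight, similarityWeightDual, hz, sq]

lemma cross_scale_similarityWeight (h2 : (2 : F) ≠ 0) {z : F} (hz : z ≠ 0) {x y : A.M}
    (hx : x ∈ A.J) (hy : y ∈ A.J) :
    A.cross (A.scale (similarityWeight z) x) (A.scale (similarityWeight z) y) =
      A.scale (similarityWeightDual z) (A.cross x y) := by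
  refine cross_scale h2 (similarityWeight_symm z) ?_ ?_ hx hy
  · intro i j k
    fin_cases i <;> fin_cases j <;> fin_cases k <;> simp [similarityWeight, hz]
  · intro i j k hij hik hjk
    fin_cases i <;> fin_cases j <;> fin_cases k <;>
      simp_all [similarityWeight, similarityWeightDual, sq]

lemma cross_scale_similarityWeightDual (h2 : (2 : F) ≠ 0) {z : F} (hz : z ≠ 0) {x y : A.M}
    (hx : x ∈ A.J) (hy : y ∈ A.J) :
    A.cross (A.scale (similarityWeightDual z) x) (A.scale (similarityWeightDual z) y) =
      z • A.scale (similarityWeight z) (A.cross x y) := by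
  have h : z • A.scale (similarityWeight z) (A.cross x y) =
      A.scale (z • similarityWeight z) (A.cross x y) := by
    ext i j
    exact smul_smul _ _ _
  rw [h]
  refine cross_scale h2 (similarityWeightDual_symm z) ?_ ?_ hx hy
  · intro i j k
    fin_cases i <;> fin_cases j <;> fin_cases k <;> simp [similarityWeightDual, sq, mul_assoc]
  · intro i j k hij hik hjk
    fin_cases i <;> fin_cases j <;> fin_cases k <;>
      simp_all [similarityWeight, similarityWeightDual, sq]

end ReducedAlbert

/-- If `J` is a reduced Albert algebra, then for every `ζ ∈ F^×` the algebra
with involution `B(J, F×F, ζ)` is isomorphic to `B(J, F×F)` (= `B(J, F×F, 1)`). -/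
theorem stmt3 {F : Type u} [Field F] (h2 : (2 : F) ≠ 0) (h3 : (3 : F) ≠ 0)
    (A : ReducedAlbert.{u, v} F) (ζ : Fˣ) :
    ∃ f : A.Bam →ₗ[F] A.Bam,
      Set.BijOn f (A.Bsub : Set A.Bam) (A.Bsub : Set A.Bam) ∧
      (∀ x ∈ A.Bsub, ∀ y ∈ A.Bsub, f (A.bmul (ζ : F) x y) = A.bmul 1 (f x) (f y)) ∧
      (∀ x ∈ A.Bsub, f (A.binv x) = A.binv (f x)) := by
  open ReducedAlbert in
  have hz : (ζ : F) ≠ 0 := ζ.ne_zero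
  set w := similarityWeight (ζ : F)
  set w' := similarityWeightDual (ζ : F)
  have hww (i j) : w i j * w' i j = ζ := similarityWeight_mul_dual hz i j
  have hws (i j) : w i j = w j i := similarityWeight_symm _ i j
  have hws' (i j) : w' i j = w' j i := similarityWeightDual_symm _ i j
  have hw0 (i j) : w i j ≠ 0 := left_ne_zero_of_mul (hww i j ▸ hz)
  have hw0' (i j) : w' i j ≠ 0 := right_ne_zero_of_mul (hww i j ▸ hz)
  have htb (x y : A.M) : A.tb (A.scale w x) (A.scale w' y) = ζ * A.tb x y :=
    tb_scale (fun i j => by rw [hws' j i, hww]) x y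
  refine ⟨LinearMap.id.prodMap ((A.scale w).prodMap ((A.scale w').prodMap LinearMap.id)),
    Set.InvOn.bijOn (f' := LinearMap.id.prodMap ((A.scale fun i j => (w i j)⁻¹).prodMap
      ((A.scale fun i j => (w' i j)⁻¹).prodMap LinearMap.id))) ⟨?_, ?_⟩ ?_ ?_, ?_, ?_⟩
  · rintro ⟨α, j, j', β⟩ -
    simp only [LinearMap.prodMap_apply, LinearMap.id_apply,
      scale_scale_eq_self fun i j => inv_mul_cancel₀ (hw0 i j),
      scale_scale_eq_self fun i j => inv_mul_cancel₀ (hw0' i j)]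
  · rintro ⟨α, j, j', β⟩ -
    simp only [LinearMap.prodMap_apply, LinearMap.id_apply,
      scale_scale_eq_self fun i j => mul_inv_cancel₀ (hw0 i j),
      scale_scale_eq_self fun i j => mul_inv_cancel₀ (hw0' i j)]
  · exact fun x hx => ⟨scale_mem_J hws hx.1, scale_mem_J hws' hx.2⟩
  · exact fun x hx => ⟨scale_mem_J (fun i j => by rw [hws]) hx.1,
      scale_mem_J (fun i j => by rw [hws']) hx.2⟩
  · rintro ⟨α, j, j', β⟩ ⟨hj, hj'⟩ ⟨δ, k, k', ε⟩ ⟨hk, hk'⟩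
    simp only [bmul, LinearMap.prodMap_apply, LinearMap.id_apply, map_add, map_smul, one_mul,
      one_smul, htb, w, w', cross_scale_similarityWeight h2 hz hj hk,
      cross_scale_similarityWeightDual h2 hz hj' hk']
  · exact fun x _ => rfl
end
end

section
/- Let J be a reduced Albert algebra over a field F of characteristic not 2 or 3 and let ζ ∈ F^×. The F-linear map f: B(J,F×F) → B(J,F×F,ζ) defined by f(α,j;j',β) := (ζα, j; j', β) is a similarity with multiplier ζ from the triple system associated to B(J,F×F) to the triple system associated to B(J,F×F,ζ). In particular, B(J,F×F,ζ) and B(J,F×F) are similar. -/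
set_option synthInstance.maxHeartbeats 1000000
set_option maxHeartbeats 1000000

noncomputable section

open scoped TensorProduct

universe u v

namespace ReducedAlbert

variable {F : Type u} [Field F] (A : ReducedAlbert.{u, v} F)

lemma jmul_smul_left (c : F) (x y : A.M) : A.jmul (c • x) y = c • A.jmul x y := by
  simp only [jmul, smul_mul_assoc, mul_smul_comm, ← smul_add]
  rw [smul_comm]

lemma trace_add (x y : A.M) : A.trace (x + y) = A.trace x + A.trace y := by
  simp only [trace, Matrix.add_apply, QuadraticMap.polar_add_left, Finset.sum_add_distrib,
    mul_add]

lemma trace_smul (c : F) (x : A.M) : A.trace (c • x) = c * A.trace x := by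
  simp only [trace, Matrix.smul_apply, QuadraticMap.polar_smul_left, smul_eq_mul,
    ← Finset.mul_sum]
  ring

lemma jmul_add_self (x y : A.M) :
    A.jmul (x + y) (x + y) = A.jmul x x + A.jmul y y + (2 : F) • A.jmul x y := by
  simp only [jmul, add_mul, mul_add]
  module

lemma tb_smul_left (c : F) (x y : A.M) : A.tb (c • x) y = c * A.tb x y := by
  rw [tb, jmul_smul_left, trace_smul, tb]

lemma tb_comm (x y : A.M) : A.tb x y = A.tb y x := by
  rw [tb, tb, jmul, jmul, add_comm]

lemma tb_zero_left (y : A.M) : A.tb 0 y = 0 := by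
  simpa using A.tb_smul_left 0 0 y

lemma tb_zero_right (x : A.M) : A.tb x 0 = 0 := by
  rw [tb_comm, tb_zero_left]

lemma cross_eq (x y : A.M) :
    A.cross x y = (2 : F) • A.jmul x y - A.trace x • y - A.trace y • x
      + ((2 : F)⁻¹ * (2 * A.trace x * A.trace y - 2 * A.tb x y)) • (1 : A.M) := by
  simp only [cross, sharp, tb, jmul_add_self, trace_add, trace_smul]
  module

lemma cross_smul_left (c : F) (x y : A.M) : A.cross (c • x) y = c • A.cross x y := by
  simp only [cross_eq, jmul_smul_left, trace_smul, tb_smul_left]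
  module

lemma cross_zero_left (y : A.M) : A.cross 0 y = 0 := by
  simpa using A.cross_smul_left 0 0 y

/-- The map `f(α,j;j',β) = (ζα, j; j', β)`. -/
def scaleFst (ζ : F) : A.Bam →ₗ[F] A.Bam where
  toFun p := (ζ * p.1, p.2.1, p.2.2.1, p.2.2.2)
  map_add' p q := Prod.ext (by simp [mul_add]) rfl
  map_smul' c p := Prod.ext (by simp [mul_left_comm]) rfl

/-- The map `g(α,j;j',β) = (ζα, ζj; j', ζβ)`, which satisfies `f(x)·f(y)‾ = g(x·ȳ)`. -/
def scaleHermitian (ζ : F) : A.Bam →ₗ[F] A.Bam where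
  toFun p := (ζ * p.1, ζ • p.2.1, p.2.2.1, ζ * p.2.2.2)
  map_add' p q := by simp [mul_add]
  map_smul' c p := by simp [mul_left_comm, smul_comm ζ c]

lemma bmul_scaleFst_binv (ζ : F) (x y : A.Bam) :
    A.bmul ζ (A.scaleFst ζ x) (A.binv (A.scaleFst ζ y))
      = A.scaleHermitian ζ (A.bmul 1 x (A.binv y)) := by
  refine Prod.ext ?_ (Prod.ext ?_ (Prod.ext ?_ ?_)) <;>
    simp only [scaleFst, scaleHermitian, bmul, binv, LinearMap.coe_mk, AddHom.coe_mk]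
  · ring
  · module
  · ring

lemma bmul_scaleHermitian_scaleFst (ζ : F) (u z : A.Bam) :
    A.bmul ζ (A.scaleHermitian ζ u) (A.scaleFst ζ z) = ζ • A.scaleFst ζ (A.bmul 1 u z) := by
  refine Prod.ext ?_ (Prod.ext ?_ (Prod.ext ?_ ?_)) <;>
    simp only [scaleFst, scaleHermitian, bmul, LinearMap.coe_mk, AddHom.coe_mk, tb_smul_left,
      cross_smul_left, Prod.smul_fst, Prod.smul_snd, smul_eq_mul]
  · ring
  · module
  · module
  · ring

lemma bmul_s0_scaleFst (ζ : F) (z : A.Bam) :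
    A.bmul ζ A.s0 (A.scaleFst ζ z) = A.scaleFst ζ (A.bmul 1 A.s0 z) := by
  refine Prod.ext ?_ (Prod.ext ?_ (Prod.ext ?_ ?_)) <;>
    simp [scaleFst, bmul, s0, tb_zero_left, tb_zero_right, cross_zero_left]

lemma brace_scaleFst (ζ : F) (x y z : A.Bam) :
    A.brace ζ (A.scaleFst ζ x) (A.scaleFst ζ y) (A.scaleFst ζ z)
      = ζ • A.scaleFst ζ (A.brace 1 x y z) := by
  simp only [brace, bmul_scaleFst_binv, bmul_scaleHermitian_scaleFst, map_add, map_sub,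
    smul_add, smul_sub]

lemma bform_scaleFst (ζ : F) (x y : A.Bam) :
    A.bform ζ (A.scaleFst ζ x) (A.scaleFst ζ y) = ζ * A.bform 1 x y := by
  rw [bform, bform, bformS, bformS, bmul_scaleFst_binv, bmul_scaleFst_binv, ← map_sub]
  simp [scaleHermitian, bmul, s0, tb_zero_right]

lemma tform_scaleFst (ζ : F) (x y z : A.Bam) :
    A.tform ζ (A.scaleFst ζ x) (A.scaleFst ζ y) (A.scaleFst ζ z)
      = ζ • A.scaleFst ζ (A.tform 1 x y z) := by
  have hb := A.bform_scaleFst ζ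
  simp only [bform] at hb
  simp only [tform, tformS, bmul_s0_scaleFst, brace_scaleFst, hb, map_sub, map_smul]
  module

lemma bijOn_scaleFst (ζ : Fˣ) :
    Set.BijOn (A.scaleFst (ζ : F)) (A.Bsub : Set A.Bam) (A.Bsub : Set A.Bam) := by
  refine Set.InvOn.bijOn (f' := A.scaleFst ((ζ⁻¹ : Fˣ) : F)) ⟨?_, ?_⟩ (fun _ h => h)
    (fun _ h => h) <;> intro p _ <;> simp [scaleFst]

end ReducedAlbert

/-- The `F`-linear map `f(α,j;j',β) := (ζα, j; j', β)` is a similarity with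
multiplier `ζ` from the triple system associated to `B(J,F×F)` to the one associated to
`B(J,F×F,ζ)`; in particular the two algebras are similar. -/
theorem stmt4 {F : Type u} [Field F] (h2 : (2 : F) ≠ 0) (h3 : (3 : F) ≠ 0)
    (A : ReducedAlbert.{u, v} F) (ζ : Fˣ) :
    IsLinearMap F (fun p : A.Bam => (((ζ : F) * p.1, p.2.1, p.2.2.1, p.2.2.2) : A.Bam)) ∧
    Set.BijOn (fun p : A.Bam => (((ζ : F) * p.1, p.2.1, p.2.2.1, p.2.2.2) : A.Bam))
      (A.Bsub : Set A.Bam) (A.Bsub : Set A.Bam) ∧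
    (∀ x ∈ A.Bsub, ∀ y ∈ A.Bsub,
      A.bform (ζ : F) (((ζ : F) * x.1, x.2.1, x.2.2.1, x.2.2.2) : A.Bam)
          (((ζ : F) * y.1, y.2.1, y.2.2.1, y.2.2.2) : A.Bam)
        = (ζ : F) * A.bform 1 x y) ∧
    (∀ x ∈ A.Bsub, ∀ y ∈ A.Bsub, ∀ z ∈ A.Bsub,
      A.tform (ζ : F) (((ζ : F) * x.1, x.2.1, x.2.2.1, x.2.2.2) : A.Bam)
          (((ζ : F) * y.1, y.2.1, y.2.2.1, y.2.2.2) : A.Bam)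
          (((ζ : F) * z.1, z.2.1, z.2.2.1, z.2.2.2) : A.Bam)
        = (ζ : F) • (((ζ : F) * (A.tform 1 x y z).1, (A.tform 1 x y z).2.1,
            (A.tform 1 x y z).2.2.1, (A.tform 1 x y z).2.2.2) : A.Bam)) := by
  exact ⟨(A.scaleFst (ζ : F)).isLinear, A.bijOn_scaleFst ζ,
    fun x _ y _ => A.bform_scaleFst ζ x y, fun x _ y _ z _ => A.tform_scaleFst ζ x y z⟩
end
end
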